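/- The homology of Sym₃ of the generic 2×4 matrix complex vanishes in positive degrees: for R = ℚ[x₁₁,…,x₂₄] and M the generic 2×4 matrix, the complex R⁴ ← R¹² ← R¹² ← R⁴ given by Sym₃ of (R⁴ →^M R²) has H_i = 0 for i = 1, 2, 3, and H₀ has Hilbert series 4/(1−T)⁵. -/

import Mathlib

open MvPolynomial

/-- The polynomial ring `ℚ[x_{ij}]`, `1 ≤ i ≤ 2`, `1 ≤ j ≤ 4`. -/
noncomputable abbrev Rgen : Type := MvPolynomial (Fin 2 × Fin 4) ℚ

/-- The entries of the generic `2 × 4` matrix. -/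
noncomputable def xv (i : Fin 2) (j : Fin 4) : Rgen := X (i, j)

/-- Ordered pairs indexing a basis of `Λ²(R⁴)`. -/
abbrev Pair4 := {p : Fin 4 × Fin 4 // p.1 < p.2}

/-- Ordered triples indexing a basis of `Λ³(R⁴)`. -/
abbrev Triple4 := {t : Fin 4 × Fin 4 × Fin 4 // t.1 < t.2.1 ∧ t.2.1 < t.2.2}

/-- The differential `Sym₃(F)₁ = F₁ ⊗ Sym₂F₀ → Sym₃F₀ = Sym₃(F)₀`, `h_j ⊗ s ↦ d(h_j)·s`,
in the monomial bases: the basis of `Sym_k(F₀)` is `g₁^{k-a} g₂^{a}`, `a = 0, …, k`. -/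
noncomputable def d1 : Matrix (Fin 4) (Fin 4 × Fin 3) Rgen :=
  fun b p => if (b : ℕ) = (p.2 : ℕ) then xv 0 p.1
    else if (b : ℕ) = (p.2 : ℕ) + 1 then xv 1 p.1 else 0

/-- The differential `Sym₃(F)₂ = Λ²F₁ ⊗ F₀ → F₁ ⊗ Sym₂F₀ = Sym₃(F)₁`,
`h_j∧h_k ⊗ g ↦ h_j ⊗ d(h_k)·g − h_k ⊗ d(h_j)·g`. -/
noncomputable def d2 : Matrix (Fin 4 × Fin 3) (Pair4 × Fin 2) Rgen :=
  fun q c =>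
    (if q.1 = c.1.1.1 then
      ∑ i' : Fin 2, if (q.2 : ℕ) = (c.2 : ℕ) + (i' : ℕ) then xv i' c.1.1.2 else 0
     else 0) -
    (if q.1 = c.1.1.2 then
      ∑ i' : Fin 2, if (q.2 : ℕ) = (c.2 : ℕ) + (i' : ℕ) then xv i' c.1.1.1 else 0
     else 0)

/-- The differential `Sym₃(F)₃ = Λ³F₁ → Λ²F₁ ⊗ F₀ = Sym₃(F)₂`,
`h_j∧h_k∧h_l ↦ h_j∧h_k ⊗ d(h_l) − h_j∧h_l ⊗ d(h_k) + h_k∧h_l ⊗ d(h_j)`. -/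
noncomputable def d3 : Matrix (Pair4 × Fin 2) Triple4 Rgen :=
  fun q c =>
    (if q.1.1 = (c.1.1, c.1.2.1) then xv q.2 c.1.2.2 else 0) -
    (if q.1.1 = (c.1.1, c.1.2.2) then xv q.2 c.1.2.1 else 0) +
    (if q.1.1 = (c.1.2.1, c.1.2.2) then xv q.2 c.1.1 else 0)

/-- The submodule of degree-`d` homogeneous vectors in `R⁴`. -/
noncomputable def homogPart (d : ℕ) : Submodule ℚ (Fin 4 → Rgen) :=
  Submodule.pi Set.univ fun _ => homogeneousSubmodule (Fin 2 × Fin 4) ℚ d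

section TriangularMatching

variable {K σ ι κ : Type*} [Field K]

/-- A matching of the column basis of `D` (restricted to monomials avoiding `G'`) with the monomial
multiples of the row basis that do not avoid `G`: the column `c` has the scalar multiple of a
variable `var c` in row `row c`, and this entry strictly dominates the remaining entries of the
column for the given weights. -/
structure TriangularMatching (D : Matrix ι κ (MvPolynomial σ K))
    (G : ι → Finset σ) (G' : κ → Finset σ) where
  coef : ι → κ → K
  entry : ι → κ → σ
  row : κ → ι
  wtVar : σ → ℕ
  wtRow : ι → ℕ
  rank : σ → ℕ
  matrix_eq : ∀ b c, D b c = C (coef b c) * X (entry b c)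
  coef_row : ∀ c, coef (row c) c ≠ 0
  rank_inj : ∀ b, ∀ x ∈ G b, ∀ y ∈ G b, rank x = rank y → x = y
  exists_column : ∀ b, ∀ x ∈ G b, ∃ c, row c = b ∧ entry (row c) c = x
  column_unique : ∀ c c', row c = row c' → entry (row c) c = entry (row c') c' → c = c'
  entry_mem : ∀ c, entry (row c) c ∈ G (row c)
  mem_iff : ∀ c x, x ∈ G' c ↔ x ∈ G (row c) ∧ rank x < rank (entry (row c) c)
  weight_lt : ∀ b c, b ≠ row c → coef b c ≠ 0 →
    wtVar (entry b c) + wtRow b < wtVar (entry (row c) c) + wtRow (row c)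

/-- The monomials of degree satisfying `P` that are divisible by no variable in `S`. -/
def avoidingExponents (S : Finset σ) (P : ℕ → Prop) : Set (σ →₀ ℕ) :=
  {m | P m.degree ∧ ∀ x ∈ S, m x = 0}

/-- Vectors whose `b`-th coordinate only involves monomials of degree satisfying `P` that are
divisible by no variable in `G b`. -/
noncomputable def avoiding (K : Type*) [Field K] (G : ι → Finset σ) (P : ℕ → Prop) :
    Submodule K (ι → MvPolynomial σ K) :=
  Submodule.pi Set.univ fun b => restrictSupport K (avoidingExponents (G b) P)

theorem mem_avoiding {G : ι → Finset σ} {P : ℕ → Prop} {v : ι → MvPolynomial σ K} :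
    v ∈ avoiding K G P ↔
      ∀ b m, coeff m (v b) ≠ 0 → P m.degree ∧ ∀ x ∈ G b, m x = 0 := by
  simp only [avoiding, Submodule.mem_pi, Set.mem_univ, true_imp_iff, mem_restrictSupport_iff,
    Set.subset_def, Finset.mem_coe, mem_support_iff, avoidingExponents, Set.mem_ofPred_eq]

theorem avoiding_mono {G : ι → Finset σ} {P Q : ℕ → Prop} (h : ∀ d, P d → Q d) :
    avoiding K G P ≤ avoiding K G Q := fun v hv => by
  rw [mem_avoiding] at hv ⊢
  exact fun b m hm => ⟨h _ (hv b m hm).1, (hv b m hm).2⟩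

theorem mem_of_single_monomial_mem [Fintype ι] [DecidableEq ι]
    {V : Submodule K (ι → MvPolynomial σ K)} {v : ι → MvPolynomial σ K}
    (h : ∀ b m, coeff m (v b) ≠ 0 → Pi.single b (monomial m (1 : K)) ∈ V) : v ∈ V := by
  rw [← Finset.univ_sum_single v]
  refine Submodule.sum_mem _ fun b _ => ?_
  have : (Pi.single b (v b) : ι → MvPolynomial σ K) =
      ∑ m ∈ (v b).support, coeff m (v b) • Pi.single b (monomial m (1 : K)) := by
    conv_lhs => rw [(v b).as_sum]
    rw [← LinearMap.single_apply (R := K), map_sum]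
    refine Finset.sum_congr rfl fun m _ => ?_
    rw [LinearMap.single_apply, ← Pi.single_smul, smul_monomial, smul_eq_mul, mul_one]
  rw [this]
  exact Submodule.sum_mem _ fun m hm => V.smul_mem _ (h b m (mem_support_iff.1 hm))

theorem avoiding_exponents_eq_finsuppAntidiag [Fintype σ] [DecidableEq σ] (S : Finset σ) (d : ℕ) :
    avoidingExponents S (· = d) = Finset.finsuppAntidiag Sᶜ d := by
  ext m
  simp only [avoidingExponents, Set.mem_ofPred_eq, Finset.mem_coe, Finset.mem_finsuppAntidiag']
  refine ⟨fun ⟨hd, h⟩ => ⟨hd, fun x hx => ?_⟩, fun ⟨hd, h⟩ => ⟨hd, fun x hx => ?_⟩⟩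
  · exact Finset.mem_compl.2 fun hxS => Finsupp.mem_support_iff.1 hx (h x hxS)
  · by_contra h0
    exact Finset.mem_compl.1 (h (Finsupp.mem_support_iff.2 h0)) hx

theorem finrank_avoiding [Fintype ι] [Fintype σ] [DecidableEq σ] (G : ι → Finset σ) (d : ℕ) :
    Module.finrank K (avoiding K G (· = d)) =
      ∑ b, ((G b)ᶜ.card + d - 1).choose d := by
  let e : avoiding K G (· = d) ≃ₗ[K]
      (∀ b, restrictSupport K (avoidingExponents (G b) (· = d))) :=
    { toFun := fun v b => ⟨v.1 b, v.2 b trivial⟩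
      invFun := fun v => ⟨fun b => v b, fun b _ => (v b).2⟩
      map_add' := fun _ _ => rfl
      map_smul' := fun _ _ => rfl
      left_inv := fun _ => rfl
      right_inv := fun _ => rfl }
  have hfin : ∀ b, Fintype (avoidingExponents (G b) (· = d)) := fun b => by
    rw [avoiding_exponents_eq_finsuppAntidiag]; infer_instance
  have : ∀ b, Module.Finite K (restrictSupport K (avoidingExponents (G b) (· = d))) := fun b =>
    Module.Finite.of_basis (basisRestrictSupport K _)
  rw [e.finrank_eq, Module.finrank_pi_fintype]
  refine Finset.sum_congr rfl fun b _ => ?_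
  rw [Module.finrank_eq_nat_card_basis (basisRestrictSupport K _),
    avoiding_exponents_eq_finsuppAntidiag, ← Finset.card_finsuppAntidiag_nat_eq_choose,
    Nat.card_coe_set_eq, Set.ncard_coe_finset]

namespace TriangularMatching

variable {D : Matrix ι κ (MvPolynomial σ K)} {G : ι → Finset σ} {G' : κ → Finset σ}

/-- The variable in the dominating entry of the column `c`. -/
def var (T : TriangularMatching D G G') (c : κ) : σ := T.entry (T.row c) c

theorem eq_of_add_single_eq (T : TriangularMatching D G G') {c c' : κ} {m m' : σ →₀ ℕ}
    (hrow : T.row c = T.row c') (hm : ∀ x ∈ G' c, m x = 0) (hm' : ∀ x ∈ G' c', m' x = 0)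
    (h : m + Finsupp.single (T.var c) 1 = m' + Finsupp.single (T.var c') 1) : c = c' := by
  classical
  refine T.column_unique c c' hrow ?_
  have key : ∀ {c c' : κ} {m m' : σ →₀ ℕ}, T.row c = T.row c' → (∀ x ∈ G' c', m' x = 0) →
      m + Finsupp.single (T.var c) 1 = m' + Finsupp.single (T.var c') 1 →
      ¬ T.rank (T.var c) < T.rank (T.var c') := by
    intro c c' m m' hrow hm' h hlt
    have h0 := hm' (T.var c) ((T.mem_iff _ _).2 ⟨hrow ▸ T.entry_mem c, hlt⟩)
    have hne : T.var c' ≠ T.var c := fun e => by rw [e] at hlt; exact lt_irrefl _ hlt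
    have := DFunLike.congr_fun h (T.var c)
    simp [h0, hne] at this
  exact T.rank_inj (T.row c) _ (T.entry_mem c) _ (hrow ▸ T.entry_mem c')
    (le_antisymm (not_lt.1 (key hrow.symm hm h.symm)) (not_lt.1 (key hrow hm' h)))

variable [Fintype κ]

theorem eq_zero_of_add_eq_zero (T : TriangularMatching D G G') {n : κ → MvPolynomial σ K}
    (hn : n ∈ avoiding K G' fun _ => True) {n' : ι → MvPolynomial σ K}
    (hn' : n' ∈ avoiding K G fun _ => True) (h : D.mulVecLin n + n' = 0) : n = 0 := by
  classical
  rw [mem_avoiding] at hn hn'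
  by_contra hne
  obtain ⟨c₀, hc₀⟩ := Function.ne_iff.1 hne
  obtain ⟨m₀, hm₀⟩ := ne_zero_iff.1 hc₀
  obtain ⟨⟨c, m⟩, hcm, hmax⟩ := (Finset.univ.sigma fun c => (n c).support).exists_max_image
    (fun p => Finsupp.weight T.wtVar p.2 + (T.wtVar (T.var p.1) + T.wtRow (T.row p.1)))
    ⟨⟨c₀, m₀⟩, by simpa using hm₀⟩
  simp only [Finset.mem_sigma, Finset.mem_univ, true_and, mem_support_iff] at hcm hmax
  have h' := congr_arg (coeff (m + Finsupp.single (T.var c) 1)) (congr_fun h (T.row c))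
  have hzero : coeff (m + Finsupp.single (T.var c) 1) (n' (T.row c)) = 0 := by
    by_contra h0
    have := (hn' _ _ h0).2 _ (T.entry_mem c)
    simp [var] at this
  rw [Pi.add_apply, coeff_add, hzero, add_zero, Matrix.mulVecLin_apply, Matrix.mulVec, dotProduct,
    coeff_sum, Finset.sum_eq_single c, T.matrix_eq, mul_assoc, coeff_C_mul, add_comm m,
    var, coeff_X_mul] at h'
  · exact mul_ne_zero (T.coef_row c) hcm (by simpa using h')
  · intro c' _ hc'
    rw [T.matrix_eq, mul_assoc, coeff_C_mul]
    by_contra h0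
    obtain ⟨hcoef, h0⟩ := mul_ne_zero_iff.1 h0
    rw [coeff_X_mul'] at h0
    split_ifs at h0 with hmem
    · obtain ⟨m', hm'⟩ : ∃ m', m + Finsupp.single (T.var c) 1 =
          m' + Finsupp.single (T.entry (T.row c) c') 1 :=
        ⟨_, (tsub_add_cancel_of_le (Finsupp.single_le_iff.2
          (Nat.one_le_iff_ne_zero.2 (Finsupp.mem_support_iff.1 hmem)))).symm⟩
      rw [hm', add_tsub_cancel_right] at h0
      rcases eq_or_ne (T.row c) (T.row c') with hrow | hrow
      · exact hc' (T.eq_of_add_single_eq hrow (hn _ _ hcm).2 (hn _ _ h0).2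
          (by rw [hm', hrow, var])).symm
      · have hlt := T.weight_lt _ _ hrow hcoef
        have hle := hmax ⟨c', m'⟩ h0
        have hw := congr_arg (Finsupp.weight T.wtVar) hm'
        simp only [map_add, Finsupp.weight_single, one_smul, var] at hw hle
        omega
    · exact h0 rfl
  · simp

theorem single_monomial_mem [Fintype ι] [DecidableEq ι] (T : TriangularMatching D G G')
    (b : ι) (m : σ →₀ ℕ) :
    (Pi.single b (monomial m (1 : K)) : ι → MvPolynomial σ K) ∈
      (avoiding K G' fun _ => True).map (D.mulVecLin.restrictScalars K) ⊔
        avoiding K G (· = m.degree) := by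
  classical
  induction h : Finsupp.weight T.wtVar m + T.wtRow b using Nat.strong_induction_on
    generalizing b m with
  | _ k ih =>
  by_cases hgood : ∀ x ∈ G b, m x = 0
  · refine Submodule.mem_sup_right (mem_avoiding.2 fun b' m' hm' => ?_)
    rcases eq_or_ne b' b with rfl | hb
    · rw [Pi.single_eq_same, coeff_monomial] at hm'
      obtain rfl : m = m' := by by_contra hne; simp [hne] at hm'
      exact ⟨rfl, hgood⟩
    · simp [Pi.single_eq_of_ne hb] at hm'
  · push Not at hgood
    obtain ⟨x, hx, hmin⟩ := ((G b).filter fun x => m x ≠ 0).exists_min_image T.rank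
      (by obtain ⟨x, hx⟩ := hgood; exact ⟨x, by simpa using hx⟩)
    rw [Finset.mem_filter] at hx
    obtain ⟨c, rfl, rfl⟩ := T.exists_column b x hx.1
    obtain ⟨m', rfl⟩ : ∃ m', m = m' + Finsupp.single (T.var c) 1 :=
      ⟨m - Finsupp.single (T.var c) 1, (tsub_add_cancel_of_le (Finsupp.single_le_iff.2
        (Nat.one_le_iff_ne_zero.2 hx.2))).symm⟩
    set V := (avoiding K G' fun _ => True).map (D.mulVecLin.restrictScalars K) ⊔
        avoiding K G (· = (m' + Finsupp.single (T.var c) 1).degree) with hV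
    have hcol : D.mulVecLin (Pi.single c (monomial m' (1 : K))) ∈ V := by
      refine Submodule.mem_sup_left ⟨_, mem_avoiding.2 fun c' m'' hm'' => ⟨trivial, ?_⟩, rfl⟩
      rcases eq_or_ne c' c with rfl | hc
      · rw [Pi.single_eq_same, coeff_monomial] at hm''
        obtain rfl : m' = m'' := by by_contra hne; simp [hne] at hm''
        intro y hy
        obtain ⟨hy, hlt⟩ := (T.mem_iff _ _).1 hy
        by_contra hy0
        have := hmin y (Finset.mem_filter.2 ⟨hy, by simp [hy0]⟩)
        omega
      · simp [Pi.single_eq_of_ne hc] at hm''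
    have hexp : D.mulVecLin (Pi.single c (monomial m' (1 : K))) =
        ∑ b, T.coef b c •
          (Pi.single b (monomial (m' + Finsupp.single (T.entry b c) 1) (1 : K)) :
            ι → MvPolynomial σ K) := by
      ext1 b
      rw [Matrix.mulVecLin_apply, Matrix.mulVec_single, Finset.sum_apply, Finset.sum_eq_single b]
      · simp [T.matrix_eq, C_mul_X_eq_monomial, monomial_mul, smul_monomial, add_comm m']
      · intro b' _ hb; simp [Pi.single_eq_of_ne hb.symm]
      · simp
    rw [hexp, ← Finset.add_sum_erase _ _ (Finset.mem_univ (T.row c))] at hcol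
    have hrest : ∑ b ∈ Finset.univ.erase (T.row c), T.coef b c •
        (Pi.single b (monomial (m' + Finsupp.single (T.entry b c) 1) (1 : K)) :
          ι → MvPolynomial σ K) ∈ V := by
      refine Submodule.sum_mem _ fun b hb => ?_
      rcases eq_or_ne (T.coef b c) 0 with h0 | h0
      · simp [h0]
      · have hlt := T.weight_lt b c (Finset.ne_of_mem_erase hb) h0
        have := ih _ ?_ b (m' + Finsupp.single (T.entry b c) 1) rfl
        · simp only [map_add, Finsupp.degree_single] at this
          refine V.smul_mem _ ?_
          simpa only [hV, map_add, Finsupp.degree_single] using this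
        · simp only [map_add, Finsupp.weight_single, var, one_smul] at h ⊢
          omega
    have := V.sub_mem hcol hrest
    rwa [add_sub_cancel_right, Submodule.smul_mem_iff _ (T.coef_row c)] at this

/-- Every vector is, modulo the image of `D`, a combination of monomials avoiding `G`. -/
theorem exists_add_eq [Fintype ι] (T : TriangularMatching D G G') (v : ι → MvPolynomial σ K) :
    ∃ n ∈ avoiding K G' fun _ => True, ∃ n' ∈ avoiding K G fun _ => True,
      D.mulVecLin n + n' = v := by
  classical
  have : v ∈ (avoiding K G' fun _ => True).map (D.mulVecLin.restrictScalars K) ⊔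
        avoiding K G fun _ => True := mem_of_single_monomial_mem fun b m _ =>
    (sup_le_sup_left (avoiding_mono fun _ _ => trivial) _ :
      _ ⊔ avoiding K G (· = m.degree) ≤ _) (T.single_monomial_mem b m)
  obtain ⟨_, ⟨n, hn, rfl⟩, n', hn', rfl⟩ := Submodule.mem_sup.1 this
  exact ⟨n, hn, n', hn', rfl⟩

theorem exists_add_eq_of_degree [Fintype ι] (T : TriangularMatching D G G') (d : ℕ)
    (v : ι → MvPolynomial σ K) (hv : ∀ b, (v b).IsHomogeneous d) :
    ∃ n, ∃ n' ∈ avoiding K G (· = d), D.mulVecLin n + n' = v := by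
  classical
  have : v ∈ (avoiding K G' fun _ => True).map (D.mulVecLin.restrictScalars K) ⊔
        avoiding K G (· = d) := mem_of_single_monomial_mem fun b m hm => by
    have hd : m.degree = d := by rw [Finsupp.degree_eq_weight_one]; exact hv b hm
    exact hd ▸ T.single_monomial_mem b m
  obtain ⟨_, ⟨n, hn, rfl⟩, n', hn', rfl⟩ := Submodule.mem_sup.1 this
  exact ⟨n, n', hn', rfl⟩

/-- Consecutive matched matrices form an exact sequence. -/
theorem ker_eq_range {ν : Type*} [Fintype ν] {D' : Matrix κ ν (MvPolynomial σ K)}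
    {G'' : ν → Finset σ} (T : TriangularMatching D G G') (T' : TriangularMatching D' G' G'')
    (h : D * D' = 0) : LinearMap.ker D.mulVecLin = LinearMap.range D'.mulVecLin := by
  have hcomp : ∀ w, D.mulVecLin (D'.mulVecLin w) = 0 := fun w => by
    simp [Matrix.mulVec_mulVec, h]
  refine le_antisymm (fun v hv => ?_) ?_
  · obtain ⟨n, -, n', hn', rfl⟩ := T'.exists_add_eq v
    rw [LinearMap.mem_ker, map_add, hcomp, zero_add] at hv
    rw [T.eq_zero_of_add_eq_zero hn' (zero_mem _) (by rw [hv, add_zero]), add_zero]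
    exact ⟨n, rfl⟩
  · rintro _ ⟨w, rfl⟩
    exact hcomp w

theorem finrank_map_mkQ {ν : Type*} [Fintype ι] [Fintype ν] [Fintype σ] [DecidableEq σ]
    {D' : Matrix κ ν (MvPolynomial σ K)}
    {G'' : ν → Finset σ} (T : TriangularMatching D G G') (T' : TriangularMatching D' G' G'')
    (h : D * D' = 0) (d : ℕ) :
    Module.finrank K
      ((Submodule.pi Set.univ fun _ : ι => homogeneousSubmodule σ K d).map
        ((LinearMap.range D.mulVecLin).mkQ.restrictScalars K)) =
      ∑ b, ((G b)ᶜ.card + d - 1).choose d := by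
  have hmap : (Submodule.pi Set.univ fun _ : ι => homogeneousSubmodule σ K d).map
        ((LinearMap.range D.mulVecLin).mkQ.restrictScalars K) =
      (avoiding K G (· = d)).map ((LinearMap.range D.mulVecLin).mkQ.restrictScalars K) := by
    refine le_antisymm ?_ (Submodule.map_mono fun v hv b _ m hm => ?_)
    · rintro _ ⟨v, hv, rfl⟩
      obtain ⟨n, n', hn', rfl⟩ := T.exists_add_eq_of_degree d v fun b => hv b trivial
      refine ⟨n', hn', ?_⟩
      have : (LinearMap.range D.mulVecLin).mkQ (D.mulVecLin n) = 0 := by simp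
      rw [LinearMap.coe_restrictScalars, map_add, this, zero_add]
    · exact (congr_fun (congr_arg DFunLike.coe Finsupp.degree_eq_weight_one) m).symm.trans
        (mem_avoiding.1 hv b m hm).1
  have hdisj : Disjoint (avoiding K G (· = d))
      (LinearMap.ker ((LinearMap.range D.mulVecLin).mkQ.restrictScalars K)) := by
    rw [Submodule.disjoint_def]
    intro v hv hker
    obtain ⟨w, rfl⟩ : v ∈ LinearMap.range D.mulVecLin := by
      rwa [LinearMap.mem_ker, LinearMap.coe_restrictScalars, Submodule.mkQ_apply,
        Submodule.Quotient.mk_eq_zero] at hker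
    obtain ⟨u, -, n, hn, rfl⟩ := T'.exists_add_eq w
    have hcomp : D.mulVecLin (D'.mulVecLin u) = 0 := by simp [Matrix.mulVec_mulVec, h]
    rw [map_add, hcomp, zero_add] at hv ⊢
    rw [T.eq_zero_of_add_eq_zero hn (neg_mem (avoiding_mono (fun _ _ => trivial) hv))
      (add_neg_cancel _), map_zero]
  rw [hmap, ← finrank_avoiding (K := K), ← LinearMap.range_domRestrict]
  exact (LinearEquiv.ofInjective _
    (LinearMap.injective_domRestrict_iff.2 hdisj)).finrank_eq.symm

end TriangularMatching

end TriangularMatching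

/-- The variable in column `j` of the generic matrix that is a leading coefficient at position `p`
of the degenerate complex, which is a sum of four Koszul complexes. -/
def leadVar (p : ℕ) (j : Fin 4) : Fin 2 × Fin 4 := (if (j : ℕ) + p < 3 then 0 else 1, j)

/-- Exponent of the second basis vector of `R²` left after removing the variables in `s`
from position `p`. -/
def leadExp (p : ℕ) (s : List (Fin 4)) : ℕ := p - s.countP fun j => 3 < (j : ℕ) + p

/-- The three variables at position `p` whose column index precedes `j`. -/
def leadVarsBelow (p : ℕ) (j : ℕ) : Finset (Fin 2 × Fin 4) :=
  Finset.univ.filter fun x => (x.2 : ℕ) + p ≠ 3 ∧ x = leadVar p x.2 ∧ (x.2 : ℕ) < j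

/-- The position of `h_j ⊗ g₁^{2-a} g₂^a`. -/
def position₁ (c : Fin 4 × Fin 3) : ℕ := if (c.1 : ℕ) + c.2 < 3 then c.2 else c.2 + 1

/-- The position of `h_j ∧ h_k ⊗ g₁^{1-a} g₂^a`. -/
def position₂ (c : Pair4 × Fin 2) : ℕ :=
  if (c.1.1.2 : ℕ) + c.2 < 3 then c.2
  else if (c.1.1.1 : ℕ) + c.2 < 2 ∧ 2 < (c.1.1.2 : ℕ) + c.2 then c.2 + 1 else c.2 + 2

/-- The position of `h_j ∧ h_k ∧ h_l`. -/
def position₃ (c : Triple4) : ℕ := c.1.1 + c.1.2.1 + c.1.2.2 - 3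

def vars₀ (b : Fin 4) : Finset (Fin 2 × Fin 4) := leadVarsBelow b 4

def vars₁ (c : Fin 4 × Fin 3) : Finset (Fin 2 × Fin 4) := leadVarsBelow (position₁ c) c.1

def vars₂ (c : Pair4 × Fin 2) : Finset (Fin 2 × Fin 4) := leadVarsBelow (position₂ c) c.1.1.1

def vars₃ (c : Triple4) : Finset (Fin 2 × Fin 4) := leadVarsBelow (position₃ c) c.1.1

def varWeight (x : Fin 2 × Fin 4) : ℕ := 8 * (x.1 * x.2)

def positionWeight (p : ℕ) : ℕ := 4 * ((3 - p) * (3 - p))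

def entry₁ (b : Fin 4) (c : Fin 4 × Fin 3) : ℤ × Fin 2 × Fin 4 :=
  if (b : ℕ) = c.2 then (1, 0, c.1) else if (b : ℕ) = c.2 + 1 then (1, 1, c.1) else (0, 0, 0)

def entry₂ (b : Fin 4 × Fin 3) (c : Pair4 × Fin 2) : ℤ × Fin 2 × Fin 4 :=
  if b.1 = c.1.1.1 then
    if (b.2 : ℕ) = c.2 then (1, 0, c.1.1.2)
    else if (b.2 : ℕ) = c.2 + 1 then (1, 1, c.1.1.2) else (0, 0, 0)
  else if b.1 = c.1.1.2 then
    if (b.2 : ℕ) = c.2 then (-1, 0, c.1.1.1)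
    else if (b.2 : ℕ) = c.2 + 1 then (-1, 1, c.1.1.1) else (0, 0, 0)
  else (0, 0, 0)

def entry₃ (b : Pair4 × Fin 2) (c : Triple4) : ℤ × Fin 2 × Fin 4 :=
  if b.1.1 = (c.1.1, c.1.2.1) then (1, b.2, c.1.2.2)
  else if b.1.1 = (c.1.1, c.1.2.2) then (-1, b.2, c.1.2.1)
  else if b.1.1 = (c.1.2.1, c.1.2.2) then (1, b.2, c.1.1) else (0, 0, 0)

def row₁ (c : Fin 4 × Fin 3) : Fin 4 := Fin.ofNat 4 (position₁ c)

def row₂ (c : Pair4 × Fin 2) : Fin 4 × Fin 3 :=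
  (c.1.1.2, Fin.ofNat 3 (leadExp (position₂ c) [c.1.1.2]))

def row₃ (c : Triple4) : Pair4 × Fin 2 :=
  (⟨c.1.2, c.2.2⟩, Fin.ofNat 2 (leadExp (position₃ c) [c.1.2.1, c.1.2.2]))

def rowWeight₁ (b : Fin 4 × Fin 3) : ℕ :=
  positionWeight (position₁ b) + varWeight (leadVar (position₁ b) b.1) + b.1

def rowWeight₂ (b : Pair4 × Fin 2) : ℕ :=
  positionWeight (position₂ b) + varWeight (leadVar (position₂ b) b.1.1.1) +
    varWeight (leadVar (position₂ b) b.1.1.2) + b.1.1.1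

theorem d1_eq (b c) : d1 b c = C ((entry₁ b c).1 : ℚ) * X (entry₁ b c).2 := by
  unfold d1 entry₁ xv
  split_ifs <;> simp

theorem d2_eq (b c) : d2 b c = C ((entry₂ b c).1 : ℚ) * X (entry₂ b c).2 := by
  have := c.1.2.ne
  unfold d2 entry₂ xv
  simp only [Fin.sum_univ_two, Fin.val_zero, Fin.val_one, add_zero]
  split_ifs <;> first | omega | simp_all

theorem d3_eq (b c) : d3 b c = C ((entry₃ b c).1 : ℚ) * X (entry₃ b c).2 := by
  obtain ⟨⟨j, k, l⟩, h, h'⟩ := c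
  unfold d3 entry₃ xv
  have := h.ne
  have := h'.ne
  split_ifs <;> simp_all

set_option maxRecDepth 100000

def matching₁ : TriangularMatching d1 vars₀ vars₁ where
  coef b c := (entry₁ b c).1
  entry b c := (entry₁ b c).2
  row := row₁
  wtVar := varWeight
  wtRow b := positionWeight b
  rank x := x.2
  matrix_eq := d1_eq
  coef_row := by simp only [ne_eq, Int.cast_eq_zero]; decide
  rank_inj := by decide
  exists_column := by decide
  column_unique := by decide
  entry_mem := by decide
  mem_iff := by decide
  weight_lt := by simp only [ne_eq, Int.cast_eq_zero]; decide

def matching₂ : TriangularMatching d2 vars₁ vars₂ where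
  coef b c := (entry₂ b c).1
  entry b c := (entry₂ b c).2
  row := row₂
  wtVar := varWeight
  wtRow := rowWeight₁
  rank x := x.2
  matrix_eq := d2_eq
  coef_row := by simp only [ne_eq, Int.cast_eq_zero]; decide
  rank_inj := by decide
  exists_column := by decide
  column_unique := by decide
  entry_mem := by decide
  mem_iff := by decide
  weight_lt := by simp only [ne_eq, Int.cast_eq_zero]; decide

def matching₃ : TriangularMatching d3 vars₂ vars₃ where
  coef b c := (entry₃ b c).1
  entry b c := (entry₃ b c).2
  row := row₃
  wtVar := varWeight
  wtRow := rowWeight₂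
  rank x := x.2
  matrix_eq := d3_eq
  coef_row := by simp only [ne_eq, Int.cast_eq_zero]; decide
  rank_inj := by decide
  exists_column := by decide
  column_unique := by decide
  entry_mem := by decide
  mem_iff := by decide
  weight_lt := by simp only [ne_eq, Int.cast_eq_zero]; decide

theorem d1_mul_d2 : d1 * d2 = 0 := by
  ext1 b ⟨⟨⟨j, k⟩, h⟩, a⟩
  simp only [Matrix.mul_apply, Fintype.sum_prod_type_right, d1, d2, mul_sub, mul_ite, mul_zero,
    Finset.sum_sub_distrib, Finset.sum_ite_eq', Finset.mem_univ, if_true, Matrix.zero_apply]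
  fin_cases b <;> fin_cases a <;> simp [Fin.sum_univ_succ] <;> ring

theorem d2_mul_d3 : d2 * d3 = 0 := by
  ext1 ⟨i, e⟩ ⟨⟨j, k, l⟩, h, h'⟩
  have hd (q : Pair4) (a : Fin 2) : d3 (q, a) ⟨⟨j, k, l⟩, h, h'⟩ =
      (if q = ⟨(j, k), h⟩ then xv a l else 0) - (if q = ⟨(j, l), h.trans h'⟩ then xv a k else 0) +
        (if q = ⟨(k, l), h'⟩ then xv a j else 0) := by
    simp only [d3, Subtype.ext_iff]
  simp only [Matrix.mul_apply, Fintype.sum_prod_type_right, hd, mul_sub, mul_add, mul_ite, mul_zero,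
    Finset.sum_sub_distrib, Finset.sum_add_distrib, Finset.sum_ite_eq', Finset.mem_univ, if_true,
    Matrix.zero_apply, d2, Fin.sum_univ_two]
  have hjk : j ≠ k := h.ne
  have hkl : k ≠ l := h'.ne
  have hjl : j ≠ l := (h.trans h').ne
  by_cases hj : i = j
  · subst hj
    fin_cases e <;> simp [hjk, hjl] <;> ring
  by_cases hk : i = k
  · subst hk
    fin_cases e <;> simp [hj, hkl] <;> ring
  by_cases hl : i = l
  · subst hl
    fin_cases e <;> simp [hj, hk] <;> ring
  simp [hj, hk, hl]

/-- `Sym₃` of the generic `2×4` matrix complex `R⁴ → R²` is a resolution of its zeroth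
homology: `H_i = 0` for `i = 1, 2, 3`, and `H₀` has Hilbert series `4/(1−T)⁵`, i.e. its
degree-`d` graded piece has `ℚ`-dimension `4 · choose (d+4) 4`. -/
theorem sym3_generic_2x4_resolution :
    LinearMap.ker d3.mulVecLin = ⊥ ∧
    LinearMap.ker d2.mulVecLin = LinearMap.range d3.mulVecLin ∧
    LinearMap.ker d1.mulVecLin = LinearMap.range d2.mulVecLin ∧
    (∀ d : ℕ,
      Module.finrank ℚ
        (Submodule.map
          ((LinearMap.range d1.mulVecLin).mkQ.restrictScalars ℚ) (homogPart d)) =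
        4 * Nat.choose (d + 4) 4) := by
  refine ⟨?_, matching₂.ker_eq_range matching₃ d2_mul_d3,
    matching₁.ker_eq_range matching₂ d1_mul_d2, fun d => ?_⟩
  · refine (Submodule.eq_bot_iff _).2 fun v hv => ?_
    have hvars : ∀ c, vars₃ c = ∅ := by decide
    refine matching₃.eq_zero_of_add_eq_zero (mem_avoiding.2 fun c m _ => ⟨trivial, ?_⟩)
      (zero_mem _) (by rw [LinearMap.mem_ker.1 hv, add_zero])
    simp [hvars]
  · have hvars : ∀ b, (vars₀ b)ᶜ.card = 5 := by decide
    have := matching₁.finrank_map_mkQ matching₂ d1_mul_d2 d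
    simp only [hvars, Finset.sum_const, Finset.card_univ, Fintype.card_fin, smul_eq_mul] at this
    rw [homogPart, this, show 5 + d - 1 = d + 4 by omega, Nat.choose_symm_add]
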